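/- Let Ω ⊂ ℝ be an open bounded interval, let f satisfy hypothesis (F), and let the data satisfy the smooth-data hypothesis (I∞). Then there exist τ > 0 and C > 0 such that for every ε ∈ (0,1) the classical solution (v_ε,u_ε,Θ_ε) of the regularized problem (P_ε) satisfies ∫_Ω v_{εx}²(·,t) ≤ C, ∫_Ω u_{εxx}²(·,t) ≤ C and ∫_Ω Θ_{εx}²(·,t) ≤ C for all t ∈ (0,τ), as well as ∫₀^τ∫_Ω Θ_{εxx}² ≤ C. -/

import Mathlib

open MeasureTheory Filter Set Function

noncomputable section

/-- Integral over `Ω = (a,b)`. -/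
def intOm (a b : ℝ) (g : ℝ → ℝ) : ℝ := ∫ x in Ioo a b, g x

/-- Double integral over `Ω × (0,T)`. -/
def intOmT (a b T : ℝ) (F : ℝ → ℝ → ℝ) : ℝ :=
  ∫ p in (Ioo a b) ×ˢ (Ioo 0 T), F p.1 p.2

/-- Squared `L²(Ω)` integral of `g`. -/
def sqOm (a b : ℝ) (g : ℝ → ℝ) : ℝ := ∫ x in Ioo a b, (g x) ^ 2

/-- `L²(Ω)` norm. -/
def nrmL2 (a b : ℝ) (g : ℝ → ℝ) : ℝ := (∫ x in Ioo a b, (g x) ^ 2) ^ (1 / 2 : ℝ)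

/-- `L¹(Ω)` norm. -/
def nrmL1 (a b : ℝ) (g : ℝ → ℝ) : ℝ := ∫ x in Ioo a b, |g x|

/-- Membership in `L²(Ω)`. -/
def MemL2 (a b : ℝ) (g : ℝ → ℝ) : Prop :=
  AEStronglyMeasurable g (volume.restrict (Ioo a b)) ∧
    IntegrableOn (fun x => (g x) ^ 2) (Ioo a b)

/-- Zero-trace weak derivative on `(a,b)`: `g ∈ W₀^{1,1}(a,b)` with weak derivative `g'`
(integration by parts against all smooth test functions, with no boundary terms). -/
def WeakDerivZ (a b : ℝ) (g g' : ℝ → ℝ) : Prop :=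
  ∀ ψ : ℝ → ℝ, ContDiff ℝ (⊤ : ℕ∞) ψ →
    ∫ x in Ioo a b, g x * deriv ψ x = - ∫ x in Ioo a b, g' x * ψ x

/-- Interior weak derivative on `(a,b)`: `g ∈ W^{1,1}(a,b)` with weak derivative `g'`. -/
def WeakDerivI (a b : ℝ) (g g' : ℝ → ℝ) : Prop :=
  ∀ ψ : ℝ → ℝ, ContDiff ℝ (⊤ : ℕ∞) ψ → tsupport ψ ⊆ Ioo a b →
    ∫ x in Ioo a b, g x * deriv ψ x = - ∫ x in Ioo a b, g' x * ψ x

/-- Hypothesis (F) on the nonlinearity `f`, where `f'`, `f''` denote its first and second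
derivatives on `[0,∞)`: `f ∈ C²([0,∞))`, `f(0)=0`, `f' > 0` on `[0,∞)`,
and `f' ∈ W^{1,∞}((0,∞))` (i.e. `f'` and `f''` are bounded). -/
structure HypF (f f' f'' : ℝ → ℝ) : Prop where
  hasDeriv₁ : ∀ x ∈ Ici (0 : ℝ), HasDerivWithinAt f (f' x) (Ici 0) x
  hasDeriv₂ : ∀ x ∈ Ici (0 : ℝ), HasDerivWithinAt f' (f'' x) (Ici 0) x
  cont₂ : ContinuousOn f'' (Ici 0)
  zero : f 0 = 0
  pos : ∀ x ∈ Ici (0 : ℝ), 0 < f' x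
  bdd : ∃ M : ℝ, ∀ x ∈ Ici (0 : ℝ), |f' x| ≤ M ∧ |f'' x| ≤ M

/-- Partial derivative in the first (spatial) variable. -/
def pdx (w : ℝ → ℝ → ℝ) : ℝ → ℝ → ℝ := fun x t => deriv (fun y => w y t) x

/-- Partial derivative in the second (time) variable. -/
def pdt (w : ℝ → ℝ → ℝ) : ℝ → ℝ → ℝ := fun x t => deriv (fun s => w x s) t

/-- Test functions in `C₀^∞(Ω × [0,T))`. -/
structure TestU (a b T : ℝ) (φ : ℝ → ℝ → ℝ) : Prop where
  smooth : ContDiff ℝ (⊤ : ℕ∞) (uncurry φ)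
  suppx : ∃ K : Set ℝ, IsCompact K ∧ K ⊆ Ioo a b ∧ ∀ x t, x ∉ K → φ x t = 0
  suppt : ∃ T' : ℝ, T' < T ∧ ∀ x t, T' ≤ t → φ x t = 0

/-- Test functions in `C^∞(Ω̄ × [0,T))`, compactly supported in time. -/
structure TestT (T : ℝ) (φ : ℝ → ℝ → ℝ) : Prop where
  smooth : ContDiff ℝ (⊤ : ℕ∞) (uncurry φ)
  suppt : ∃ T' : ℝ, T' < T ∧ ∀ x t, T' ≤ t → φ x t = 0

/-- Test functions in `C₀^∞(Ω × (0,T))`. -/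
structure TestInt (a b T : ℝ) (φ : ℝ → ℝ → ℝ) : Prop where
  smooth : ContDiff ℝ (⊤ : ℕ∞) (uncurry φ)
  suppx : ∃ K : Set ℝ, IsCompact K ∧ K ⊆ Ioo a b ∧ ∀ x t, x ∉ K → φ x t = 0
  supptime : ∃ K : Set ℝ, IsCompact K ∧ K ⊆ Ioo 0 T ∧ ∀ x t, t ∉ K → φ x t = 0

/-- Definition (W): weak solution of (P) on `Ω × (0,T)`.  Here `ut`, `ux`, `Θx` denote
the weak derivatives of `u` (in time and space) and of `Θ` (in space). -/
structure IsWeakSol (a b T : ℝ) (f f' : ℝ → ℝ) (u0 u0t Θ0 : ℝ → ℝ)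
    (u ut ux Θ Θx : ℝ → ℝ → ℝ) : Prop where
  u_sliceL1 : ∀ t ∈ Icc 0 T, IntegrableOn (fun x => u x t) (Ioo a b)
  u_contL1 : ∀ t₀ ∈ Icc 0 T,
    Tendsto (fun t => ∫ x in Ioo a b, |u x t - u x t₀|) (nhdsWithin t₀ (Icc 0 T)) (nhds 0)
  u_int : IntegrableOn (fun p : ℝ × ℝ => u p.1 p.2) ((Ioo a b) ×ˢ (Ioo 0 T))
  ux_int : IntegrableOn (fun p : ℝ × ℝ => ux p.1 p.2) ((Ioo a b) ×ˢ (Ioo 0 T))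
  u_W0 : ∀ᵐ t ∂volume.restrict (Ioo 0 T), WeakDerivZ a b (fun x => u x t) (fun x => ux x t)
  Θ_int : IntegrableOn (fun p : ℝ × ℝ => Θ p.1 p.2) ((Ioo a b) ×ˢ (Ioo 0 T))
  Θx_int : IntegrableOn (fun p : ℝ × ℝ => Θx p.1 p.2) ((Ioo a b) ×ˢ (Ioo 0 T))
  Θ_W : ∀ᵐ t ∂volume.restrict (Ioo 0 T), WeakDerivI a b (fun x => Θ x t) (fun x => Θx x t)
  Θ_nonneg : ∀ᵐ p ∂volume.restrict ((Ioo a b) ×ˢ (Ioo 0 T)), 0 ≤ Θ p.1 p.2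
  ut_weak : ∀ φ : ℝ → ℝ → ℝ, TestInt a b T φ →
    intOmT a b T (fun x t => u x t * pdt φ x t) = - intOmT a b T (fun x t => ut x t * φ x t)
  ut_int : IntegrableOn (fun p : ℝ × ℝ => ut p.1 p.2) ((Ioo a b) ×ˢ (Ioo 0 T))
  g1_int : IntegrableOn (fun p : ℝ × ℝ => f' (Θ p.1 p.2) * Θx p.1 p.2)
    ((Ioo a b) ×ˢ (Ioo 0 T))
  g2_int : IntegrableOn (fun p : ℝ × ℝ => f' (Θ p.1 p.2) * Θx p.1 p.2 * ut p.1 p.2)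
    ((Ioo a b) ×ˢ (Ioo 0 T))
  g3_int : IntegrableOn (fun p : ℝ × ℝ => f (Θ p.1 p.2) * ut p.1 p.2)
    ((Ioo a b) ×ˢ (Ioo 0 T))
  weak_u : ∀ φ : ℝ → ℝ → ℝ, TestU a b T φ →
    intOmT a b T (fun x t => u x t * pdt (pdt φ) x t)
        - intOm a b (fun x => u0t x * φ x 0) + intOm a b (fun x => u0 x * pdt φ x 0)
      = - intOmT a b T (fun x t => ux x t * pdx φ x t)
        - intOmT a b T (fun x t => f' (Θ x t) * Θx x t * φ x t)
  weak_Θ : ∀ φ : ℝ → ℝ → ℝ, TestT T φ →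
    - intOmT a b T (fun x t => Θ x t * pdt φ x t) - intOm a b (fun x => Θ0 x * φ x 0)
      = - intOmT a b T (fun x t => Θx x t * pdx φ x t)
        + intOmT a b T (fun x t => f' (Θ x t) * Θx x t * ut x t * φ x t)
        + intOmT a b T (fun x t => f (Θ x t) * ut x t * pdx φ x t)

/-- Continuity of `t ↦ w(·,t)` as a map `J → L²(Ω)` (with slices in `L²(Ω)`). -/
def ContL2 (a b : ℝ) (J : Set ℝ) (w : ℝ → ℝ → ℝ) : Prop :=
  (∀ t ∈ J, MemL2 a b (fun x => w x t)) ∧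
    ∀ t₀ ∈ J, Tendsto (fun t => ∫ x in Ioo a b, (w x t - w x t₀) ^ 2)
      (nhdsWithin t₀ J) (nhds 0)

/-- The regularity class (R_T):  `u ∈ C⁰([0,T];W₀^{1,2})`, `u_t ∈ C⁰([0,T];L²)`,
`Θ ∈ C⁰([0,T];L²) ∩ L²((0,T);W^{1,2})`. -/
structure RegT (a b T : ℝ) (u ut ux Θ Θx : ℝ → ℝ → ℝ) : Prop where
  u_cont : ContL2 a b (Icc 0 T) u
  ux_cont : ContL2 a b (Icc 0 T) ux
  u_W0 : ∀ t ∈ Icc (0 : ℝ) T, WeakDerivZ a b (fun x => u x t) (fun x => ux x t)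
  ut_cont : ContL2 a b (Icc 0 T) ut
  Θ_cont : ContL2 a b (Icc 0 T) Θ
  Θ_sq_int : IntegrableOn (fun p : ℝ × ℝ => (Θ p.1 p.2) ^ 2) ((Ioo a b) ×ˢ (Ioo 0 T))
  Θx_sq_int : IntegrableOn (fun p : ℝ × ℝ => (Θx p.1 p.2) ^ 2) ((Ioo a b) ×ˢ (Ioo 0 T))

/-- Data hypothesis (I), with `u0x` the weak derivative of `u0 ∈ W₀^{1,2}(Ω)`. -/
structure DataI (a b : ℝ) (u0 u0x u0t Θ0 : ℝ → ℝ) : Prop where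
  u0_L2 : MemL2 a b u0
  u0x_L2 : MemL2 a b u0x
  u0_W0 : WeakDerivZ a b u0 u0x
  u0t_L2 : MemL2 a b u0t
  Θ0_L2 : MemL2 a b Θ0
  Θ0_nonneg : ∀ᵐ x ∂volume.restrict (Ioo a b), 0 ≤ Θ0 x

/-- Smooth-data hypothesis (I∞). -/
structure SmoothData (a b : ℝ) (v0 u0 Θ0 : ℝ → ℝ) : Prop where
  v0_smooth : ContDiff ℝ (⊤ : ℕ∞) v0
  v0_supp : ∃ K : Set ℝ, IsCompact K ∧ K ⊆ Ioo a b ∧ ∀ x, x ∉ K → v0 x = 0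
  u0_smooth : ContDiff ℝ (⊤ : ℕ∞) u0
  u0_supp : ∃ K : Set ℝ, IsCompact K ∧ K ⊆ Ioo a b ∧ ∀ x, x ∉ K → u0 x = 0
  Θ0_smooth : ContDiff ℝ (⊤ : ℕ∞) Θ0
  Θ0_pos : ∀ x ∈ Icc a b, 0 < Θ0 x
  Θ0x_supp : ∃ K : Set ℝ, IsCompact K ∧ K ⊆ Ioo a b ∧ ∀ x, x ∉ K → deriv Θ0 x = 0

/-- Classical solution of the regularized problem (P_ε), of class
`C^{4,1} × C^{2,1} × C^{2,1}(Ω̄ × [0,∞))`, with positive temperature. -/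
structure IsClassicalSolEps (a b : ℝ) (f : ℝ → ℝ) (ε : ℝ) (v0 u0 Θ0 : ℝ → ℝ)
    (v u Θ : ℝ → ℝ → ℝ) : Prop where
  diffx_v : ∀ k < 4, ∀ x ∈ Icc a b, ∀ t ∈ Ici (0 : ℝ),
    DifferentiableAt ℝ (fun y => pdx^[k] v y t) x
  difft_v : ∀ x ∈ Icc a b, ∀ t ∈ Ici (0 : ℝ), DifferentiableAt ℝ (fun s => v x s) t
  cont_v : ∀ k ≤ 4, ContinuousOn (uncurry (pdx^[k] v)) ((Icc a b) ×ˢ (Ici 0))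
  contt_v : ContinuousOn (uncurry (pdt v)) ((Icc a b) ×ˢ (Ici 0))
  diffx_u : ∀ k < 2, ∀ x ∈ Icc a b, ∀ t ∈ Ici (0 : ℝ),
    DifferentiableAt ℝ (fun y => pdx^[k] u y t) x
  difft_u : ∀ x ∈ Icc a b, ∀ t ∈ Ici (0 : ℝ), DifferentiableAt ℝ (fun s => u x s) t
  cont_u : ∀ k ≤ 2, ContinuousOn (uncurry (pdx^[k] u)) ((Icc a b) ×ˢ (Ici 0))
  contt_u : ContinuousOn (uncurry (pdt u)) ((Icc a b) ×ˢ (Ici 0))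
  diffx_Θ : ∀ k < 2, ∀ x ∈ Icc a b, ∀ t ∈ Ici (0 : ℝ),
    DifferentiableAt ℝ (fun y => pdx^[k] Θ y t) x
  difft_Θ : ∀ x ∈ Icc a b, ∀ t ∈ Ici (0 : ℝ), DifferentiableAt ℝ (fun s => Θ x s) t
  cont_Θ : ∀ k ≤ 2, ContinuousOn (uncurry (pdx^[k] Θ)) ((Icc a b) ×ˢ (Ici 0))
  contt_Θ : ContinuousOn (uncurry (pdt Θ)) ((Icc a b) ×ˢ (Ici 0))
  Θ_pos : ∀ x ∈ Icc a b, ∀ t ∈ Ici (0 : ℝ), 0 < Θ x t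
  eq_v : ∀ x ∈ Ioo a b, ∀ t ∈ Ioi (0 : ℝ),
    pdt v x t = -ε * pdx^[4] v x t + pdx^[2] u x t - pdx (fun y s => f (Θ y s)) x t
  eq_u : ∀ x ∈ Ioo a b, ∀ t ∈ Ioi (0 : ℝ), pdt u x t = ε * pdx^[2] u x t + v x t
  eq_Θ : ∀ x ∈ Ioo a b, ∀ t ∈ Ioi (0 : ℝ),
    pdt Θ x t = pdx^[2] Θ x t - f (Θ x t) * pdx v x t
  bc_v : ∀ t ∈ Ioi (0 : ℝ),
    v a t = 0 ∧ v b t = 0 ∧ pdx^[2] v a t = 0 ∧ pdx^[2] v b t = 0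
  bc_u : ∀ t ∈ Ioi (0 : ℝ), u a t = 0 ∧ u b t = 0
  bc_Θ : ∀ t ∈ Ioi (0 : ℝ), pdx Θ a t = 0 ∧ pdx Θ b t = 0
  init : ∀ x ∈ Icc a b, v x 0 = v0 x ∧ u x 0 = u0 x ∧ Θ x 0 = Θ0 x

/-- Weak convergence in `L²_loc(Ω̄ × [0,∞))`. -/
def WkL2loc (a b : ℝ) (wj : ℕ → ℝ → ℝ → ℝ) (w : ℝ → ℝ → ℝ) : Prop :=
  ∀ T > (0 : ℝ), ∀ ψ : ℝ → ℝ → ℝ,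
    AEStronglyMeasurable (fun p : ℝ × ℝ => ψ p.1 p.2)
      (volume.restrict ((Icc a b) ×ˢ (Icc 0 T))) →
    IntegrableOn (fun p : ℝ × ℝ => (ψ p.1 p.2) ^ 2) ((Icc a b) ×ˢ (Icc 0 T)) →
    Tendsto (fun j => ∫ p in (Icc a b) ×ˢ (Icc 0 T), wj j p.1 p.2 * ψ p.1 p.2) atTop
      (nhds (∫ p in (Icc a b) ×ˢ (Icc 0 T), w p.1 p.2 * ψ p.1 p.2))


lemma continuous_intervalIntegral_snd {F : ℝ → ℝ → ℝ} (hF : Continuous (uncurry F)) (a b : ℝ) :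
    Continuous fun t => ∫ x in a..b, F x t :=
  intervalIntegral.continuous_parametric_intervalIntegral_of_continuous'
    (f := fun t x => F x t) (hF.comp continuous_swap) a b

lemma integral_mul_deriv_of_Ioo {a b : ℝ} (hab : a < b) {g g' k k' : ℝ → ℝ}
    (hg : Continuous g) (hg' : Continuous g') (hk : Continuous k) (hk' : Continuous k')
    (dg : ∀ x ∈ Ioo a b, HasDerivAt g (g' x) x) (dk : ∀ x ∈ Ioo a b, HasDerivAt k (k' x) x) :
    ∫ x in a..b, g x * k' x = g b * k b - g a * k a - ∫ x in a..b, g' x * k x := by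
  refine intervalIntegral.integral_mul_deriv_eq_deriv_mul_of_hasDeriv_right
    hg.continuousOn hk.continuousOn (fun x hx => ?_) (fun x hx => ?_)
    (hg'.intervalIntegrable _ _) (hk'.intervalIntegrable _ _)
  · rw [min_eq_left hab.le, max_eq_right hab.le] at hx
    exact (dg x hx).hasDerivWithinAt
  · rw [min_eq_left hab.le, max_eq_right hab.le] at hx
    exact (dk x hx).hasDerivWithinAt

lemma sub_eq_mul_integral_segment {g g' : ℝ → ℝ} (hg' : Continuous g') {c d s t : ℝ}
    (hs : s ∈ Ioo c d) (ht : t ∈ Ioo c d) (dg : ∀ r ∈ Ioo c d, HasDerivAt g (g' r) r) :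
    g s - g t = (s - t) * ∫ r in (0 : ℝ)..1, g' (t + r * (s - t)) := by
  have key : ∀ r ∈ uIcc (0 : ℝ) 1,
      HasDerivAt (fun r => g (t + r * (s - t))) ((s - t) * g' (t + r * (s - t))) r := by
    intro r hr
    rw [uIcc_of_le zero_le_one] at hr
    have hmem : t + r * (s - t) ∈ Ioo c d := by
      have := (convex_Ioo c d) ht hs (sub_nonneg.2 hr.2) hr.1 (by ring)
      simp only [smul_eq_mul] at this
      convert this using 1; ring
    have h1 : HasDerivAt (fun r : ℝ => t + r * (s - t)) (s - t) r := by
      simpa using ((hasDerivAt_id r).mul_const (s - t)).const_add t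
    have := (dg _ hmem).comp r h1
    rwa [mul_comm] at this
  have := intervalIntegral.integral_eq_sub_of_hasDerivAt key
    ((by fun_prop : Continuous fun r => (s - t) * g' (t + r * (s - t))).intervalIntegrable _ _)
  rw [intervalIntegral.integral_const_mul] at this
  rw [this]; congr 1 <;> congr 1 <;> ring

lemma tendsto_integral_slope_mul {a b c d t : ℝ} (hab : a < b) {A A' B : ℝ → ℝ → ℝ}
    (hA' : Continuous (uncurry A')) (hB : Continuous (uncurry B))
    (ht : t ∈ Ioo c d)
    (dA : ∀ x ∈ Ioo a b, ∀ s ∈ Ioo c d, HasDerivAt (A x) (A' x s) s) :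
    Tendsto (fun s => ∫ x in a..b, (s - t)⁻¹ * (A x s - A x t) * B x s) (nhdsWithin t {t}ᶜ)
      (nhds (∫ x in a..b, A' x t * B x t)) := by
  have hin : Continuous (uncurry fun x s => ∫ r in (0 : ℝ)..1, A' x (t + r * (s - t))) :=
    intervalIntegral.continuous_parametric_intervalIntegral_of_continuous'
      (f := fun (p : ℝ × ℝ) r => A' p.1 (t + r * (p.2 - t)))
      (hA'.comp (by fun_prop : Continuous fun q : (ℝ × ℝ) × ℝ =>
        (q.1.1, t + q.2 * (q.1.2 - t)))) 0 1
  have hc := continuous_intervalIntegral_snd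
    (F := fun x s => (∫ r in (0 : ℝ)..1, A' x (t + r * (s - t))) * B x s) (hin.mul hB) a b
  have hlim := (hc.tendsto t).mono_left (nhdsWithin_le_nhds (s := {t}ᶜ))
  simp only [sub_self, mul_zero, add_zero, intervalIntegral.integral_const, sub_zero,
    one_smul] at hlim
  refine hlim.congr' ?_
  filter_upwards [self_mem_nhdsWithin, mem_nhdsWithin_of_mem_nhds (Ioo_mem_nhds ht.1 ht.2)]
    with s hs hsJ
  have hne : s - t ≠ 0 := sub_ne_zero.2 hs
  refine intervalIntegral.integral_congr_Ioo_of_le hab.le fun x hx => ?_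
  have hcx : Continuous (A' x) := hA'.comp (by fun_prop : Continuous fun r : ℝ => (x, r))
  rw [sub_eq_mul_integral_segment hcx hsJ ht (dA x hx), inv_mul_cancel_left₀ hne]

lemma hasDerivAt_intervalIntegral_of_continuous {a b c d t : ℝ} (hab : a < b) {A A' : ℝ → ℝ → ℝ}
    (hA : Continuous (uncurry A)) (hA' : Continuous (uncurry A')) (ht : t ∈ Ioo c d)
    (dA : ∀ x ∈ Ioo a b, ∀ s ∈ Ioo c d, HasDerivAt (A x) (A' x s) s) :
    HasDerivAt (fun s => ∫ x in a..b, A x s) (∫ x in a..b, A' x t) t := by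
  rw [hasDerivAt_iff_tendsto_slope]
  have h := tendsto_integral_slope_mul hab hA' (B := fun _ _ => 1) continuous_const ht dA
  simp only [mul_one] at h
  refine h.congr fun s => ?_
  have i : ∀ s, IntervalIntegrable (fun x => A x s) volume a b := fun s =>
    (hA.comp (by fun_prop : Continuous fun x : ℝ => (x, s))).intervalIntegrable _ _
  rw [slope_def_field, ← intervalIntegral.integral_sub (i s) (i t),
    intervalIntegral.integral_const_mul]
  ring

lemma hasDerivAt_integral_sq {a b t : ℝ} (hab : a < b) {w wt : ℝ → ℝ → ℝ}
    (hw : Continuous (uncurry w)) (hwt : Continuous (uncurry wt)) (ht : 0 < t)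
    (dt : ∀ x ∈ Ioo a b, ∀ s > 0, HasDerivAt (w x) (wt x s) s) :
    HasDerivAt (fun s => ∫ x in a..b, (w x s) ^ 2) (∫ x in a..b, 2 * w x t * wt x t) t := by
  refine hasDerivAt_intervalIntegral_of_continuous (c := 0) (d := t + 1) hab
    (A := fun x s => (w x s) ^ 2) (A' := fun x s => 2 * w x s * wt x s) ?_ ?_
    ⟨ht, by linarith⟩ fun x hx s hs => ?_
  · exact hw.pow 2
  · exact (continuous_const.mul hw).mul hwt
  · simpa using (dt x hx s hs.1).fun_pow 2

lemma hasDerivAt_integral_deriv_sq {a b t : ℝ} (hab : a < b) {w w1 w2 wt : ℝ → ℝ → ℝ}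
    (hw : Continuous (uncurry w)) (hw1 : Continuous (uncurry w1)) (hw2 : Continuous (uncurry w2))
    (hwt : Continuous (uncurry wt)) (ht : 0 < t)
    (d0 : ∀ x ∈ Ioo a b, ∀ s > 0, HasDerivAt (fun y => w y s) (w1 x s) x)
    (d1 : ∀ x ∈ Ioo a b, ∀ s > 0, HasDerivAt (fun y => w1 y s) (w2 x s) x)
    (dt : ∀ x ∈ Ioo a b, ∀ s > 0, HasDerivAt (w x) (wt x s) s)
    (ha : ∀ s > 0, ∀ r > 0, (w a s - w a r) * (w1 a s + w1 a r) = 0)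
    (hb : ∀ s > 0, ∀ r > 0, (w b s - w b r) * (w1 b s + w1 b r) = 0) :
    HasDerivAt (fun s => ∫ x in a..b, (w1 x s) ^ 2) (-∫ x in a..b, 2 * wt x t * w2 x t) t := by
  rw [hasDerivAt_iff_tendsto_slope]
  have sl : ∀ {F : ℝ → ℝ → ℝ}, Continuous (uncurry F) → ∀ s, Continuous fun x => F x s :=
    fun hF s => hF.comp (by fun_prop : Continuous fun x : ℝ => (x, s))
  have h := (tendsto_integral_slope_mul (c := 0) (d := t + 1) hab hwt
    (B := fun x s => w2 x s + w2 x t)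
    (hw2.add (hw2.comp (by fun_prop : Continuous fun p : ℝ × ℝ => (p.1, t))))
    ⟨ht, by linarith⟩ (fun x hx s hs => dt x hx s hs.1)).neg
  have e : ∀ x, wt x t * (w2 x t + w2 x t) = 2 * wt x t * w2 x t := fun x => by ring
  simp only [e] at h
  refine h.congr' ?_
  filter_upwards [mem_nhdsWithin_of_mem_nhds (Ioi_mem_nhds ht)] with s hs
  have c := fun s => sl hw s
  have c1 := fun s => sl hw1 s
  have c2 := fun s => sl hw2 s
  have ibp := integral_mul_deriv_of_Ioo hab (g := fun x => w x s - w x t)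
    (g' := fun x => w1 x s - w1 x t) (k := fun x => w1 x s + w1 x t)
    (k' := fun x => w2 x s + w2 x t) ((c s).sub (c t)) ((c1 s).sub (c1 t)) ((c1 s).add (c1 t))
    ((c2 s).add (c2 t)) (fun x hx => (d0 x hx s hs).sub (d0 x hx t ht))
    (fun x hx => (d1 x hx s hs).add (d1 x hx t ht))
  simp only [ha s hs t ht, hb s hs t ht] at ibp
  have e2 : ∀ x, (w1 x s - w1 x t) * (w1 x s + w1 x t) = (w1 x s) ^ 2 - (w1 x t) ^ 2 :=
    fun x => by ring
  simp only [e2] at ibp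
  have i : ∀ s, IntervalIntegrable (fun x => (w1 x s) ^ 2) volume a b :=
    fun s => ((c1 s).pow 2).intervalIntegrable _ _
  rw [intervalIntegral.integral_sub (i s) (i t)] at ibp
  simp only [mul_assoc]
  rw [slope_def_field, intervalIntegral.integral_const_mul, ibp]
  ring

/-- Forward time average of `F` over `[t, t + h]`; at `h = 0` this is `F` itself. -/
def steklov (F : ℝ → ℝ → ℝ) (h x t : ℝ) : ℝ := ∫ r in (0 : ℝ)..1, F x (t + r * h)

lemma continuous_steklov {F : ℝ → ℝ → ℝ} (hF : Continuous (uncurry F)) :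
    Continuous fun p : ℝ × ℝ × ℝ => steklov F p.1 p.2.1 p.2.2 := by
  unfold steklov
  fun_prop

lemma steklov_zero (F : ℝ → ℝ → ℝ) (x t : ℝ) : steklov F 0 x t = F x t := by
  simp [steklov]

lemma hasDerivAt_steklov_time {F : ℝ → ℝ → ℝ} (hF : Continuous (uncurry F)) {h : ℝ} (hh : 0 < h)
    (x t : ℝ) : HasDerivAt (steklov F h x) (h⁻¹ * (F x (t + h) - F x t)) t := by
  have hc : Continuous (F x) := by fun_prop
  have e : steklov F h x = fun t =>
      h⁻¹ * ((∫ s in (0 : ℝ)..t + h, F x s) - ∫ s in (0 : ℝ)..t, F x s) := by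
    funext s
    have : steklov F h x s = ∫ r in (0 : ℝ)..1, F x (s + h * r) := by
      simp only [steklov, mul_comm]
    rw [this, intervalIntegral.integral_comp_add_mul _ hh.ne', smul_eq_mul,
      ← intervalIntegral.integral_interval_sub_left (a := 0) (hc.intervalIntegrable _ _)
        (hc.intervalIntegrable _ _)]
    simp
  rw [e]
  refine HasDerivAt.const_mul _ (HasDerivAt.sub ?_ ?_)
  · exact (hc.integral_hasStrictDerivAt 0 (t + h)).hasDerivAt.comp_add_const t h
  · exact (hc.integral_hasStrictDerivAt 0 t).hasDerivAt

lemma hasDerivAt_steklov_space {a b : ℝ} {F F1 : ℝ → ℝ → ℝ} (hF : Continuous (uncurry F))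
    (hF1 : Continuous (uncurry F1)) {h : ℝ} (hh : 0 < h)
    (d : ∀ x ∈ Ioo a b, ∀ s > 0, HasDerivAt (fun y => F y s) (F1 x s) x)
    {x t : ℝ} (hx : x ∈ Ioo a b) (ht : 0 < t) :
    HasDerivAt (fun y => steklov F h y t) (steklov F1 h x t) x := by
  refine hasDerivAt_intervalIntegral_of_continuous zero_lt_one
    (A := fun r y => F y (t + r * h)) (A' := fun r y => F1 y (t + r * h)) (by fun_prop)
    (by fun_prop) hx fun r hr y hy => d y hy _ ?_
  have := mul_pos hr.1 hh
  positivity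

/-- The averaged equation expresses the average of `u_xx` through differences of `u` and averages
of `v`, so it has two more space derivatives than `u_xx` itself. -/
lemma mul_steklov_eq {a b ε : ℝ} {u u2 ut v : ℝ → ℝ → ℝ} (hu2 : Continuous (uncurry u2))
    (hut : Continuous (uncurry ut)) (hv : Continuous (uncurry v)) {h : ℝ} (hh : 0 < h)
    (dt : ∀ x ∈ Ioo a b, ∀ s > 0, HasDerivAt (u x) (ut x s) s)
    (eq : ∀ x ∈ Ioo a b, ∀ s > 0, ut x s = ε * u2 x s + v x s)
    {x t : ℝ} (hx : x ∈ Ioo a b) (ht : 0 < t) :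
    ε * steklov u2 h x t = h⁻¹ * (u x (t + h) - u x t) - steklov v h x t := by
  have hcx : Continuous (ut x) := by fun_prop
  have h1 := sub_eq_mul_integral_segment (g := u x) hcx (c := 0) (d := t + h + 1) (s := t + h)
    (t := t) ⟨by positivity, by linarith⟩ ⟨ht, by linarith⟩ fun r hr => dt x hx r hr.1
  have h2 : ∫ r in (0 : ℝ)..1, ut x (t + r * (t + h - t))
      = ε * steklov u2 h x t + steklov v h x t := by
    unfold steklov
    rw [← intervalIntegral.integral_const_mul, ← intervalIntegral.integral_add
      ((by fun_prop : Continuous fun r => ε * u2 x (t + r * h)).intervalIntegrable _ _)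
      ((by fun_prop : Continuous fun r => v x (t + r * h)).intervalIntegrable _ _)]
    refine intervalIntegral.integral_congr_Ioo_of_le zero_le_one fun r hr => ?_
    have := mul_pos hr.1 hh
    rw [add_sub_cancel_left, eq x hx _ (by positivity)]
  rw [h1, h2]
  field_simp
  ring

lemma integral_mul_deriv2_nonpos {a b : ℝ} (hab : a < b) {g g1 g2 : ℝ → ℝ} (hg : Continuous g)
    (hg1 : Continuous g1) (hg2 : Continuous g2) (d0 : ∀ x ∈ Ioo a b, HasDerivAt g (g1 x) x)
    (d1 : ∀ x ∈ Ioo a b, HasDerivAt g1 (g2 x) x) (ha : g a = 0) (hb : g b = 0) :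
    ∫ x in a..b, g x * g2 x ≤ 0 := by
  rw [integral_mul_deriv_of_Ioo hab hg hg1 hg1 hg2 d0 d1, ha, hb]
  have : 0 ≤ ∫ x in a..b, g1 x * g1 x :=
    intervalIntegral.integral_nonneg hab.le fun x _ => mul_self_nonneg _
  linarith

lemma integral_steklov_mul_le {a b ε : ℝ} (hab : a < b) (hε : 0 < ε)
    {u u1 u2 ut v v1 v2 : ℝ → ℝ → ℝ}
    (hu : Continuous (uncurry u)) (hu1 : Continuous (uncurry u1)) (hu2 : Continuous (uncurry u2))
    (hut : Continuous (uncurry ut)) (hv : Continuous (uncurry v)) (hv1 : Continuous (uncurry v1))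
    (hv2 : Continuous (uncurry v2))
    (du0 : ∀ x ∈ Ioo a b, ∀ s > 0, HasDerivAt (fun y => u y s) (u1 x s) x)
    (du1 : ∀ x ∈ Ioo a b, ∀ s > 0, HasDerivAt (fun y => u1 y s) (u2 x s) x)
    (dut : ∀ x ∈ Ioo a b, ∀ s > 0, HasDerivAt (u x) (ut x s) s)
    (dv0 : ∀ x ∈ Ioo a b, ∀ s > 0, HasDerivAt (fun y => v y s) (v1 x s) x)
    (dv1 : ∀ x ∈ Ioo a b, ∀ s > 0, HasDerivAt (fun y => v1 y s) (v2 x s) x)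
    (eq : ∀ x ∈ Ioo a b, ∀ s > 0, ut x s = ε * u2 x s + v x s)
    (bu : ∀ s > 0, u a s = 0 ∧ u b s = 0) (bv : ∀ s > 0, v a s = 0 ∧ v b s = 0)
    {h t : ℝ} (hh : 0 < h) (ht : 0 < t) :
    ∫ x in a..b, steklov u2 h x t * (h⁻¹ * (u2 x (t + h) - u2 x t))
      ≤ ∫ x in a..b, steklov u2 h x t * steklov v2 h x t := by
  have cs : ∀ {F : ℝ → ℝ → ℝ}, Continuous (uncurry F) → Continuous fun x => steklov F h x t :=
    fun hF => (continuous_steklov hF).comp (by fun_prop : Continuous fun x : ℝ => (h, x, t))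
  have th : 0 < t + h := by positivity
  have vz : ∀ y, (∀ s > 0, v y s = 0) → steklov v h y t = 0 := by
    intro y hy
    rw [steklov, intervalIntegral.integral_congr_Ioo_of_le (g := fun _ => 0) zero_le_one
      (fun r hr => hy _ ?_)]
    · simp
    · have := mul_pos hr.1 hh
      positivity
  have cW := cs hu2
  have cV2 := cs hv2
  have key := integral_mul_deriv2_nonpos hab
    (g := fun x => h⁻¹ * (u x (t + h) - u x t) - steklov v h x t)
    (g1 := fun x => h⁻¹ * (u1 x (t + h) - u1 x t) - steklov v1 h x t)
    (g2 := fun x => h⁻¹ * (u2 x (t + h) - u2 x t) - steklov v2 h x t)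
    (by have := cs hv; fun_prop) (by have := cs hv1; fun_prop) (by fun_prop)
    (fun x hx => (((du0 x hx _ th).sub (du0 x hx _ ht)).const_mul _).sub
      (hasDerivAt_steklov_space hv hv1 hh dv0 hx ht))
    (fun x hx => (((du1 x hx _ th).sub (du1 x hx _ ht)).const_mul _).sub
      (hasDerivAt_steklov_space hv1 hv2 hh dv1 hx ht))
    (by simp [(bu _ th).1, (bu _ ht).1, vz a fun s hs => (bv s hs).1])
    (by simp [(bu _ th).2, (bu _ ht).2, vz b fun s hs => (bv s hs).2])
  have e : ∫ x in a..b, (h⁻¹ * (u x (t + h) - u x t) - steklov v h x t)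
        * (h⁻¹ * (u2 x (t + h) - u2 x t) - steklov v2 h x t)
      = ε * ((∫ x in a..b, steklov u2 h x t * (h⁻¹ * (u2 x (t + h) - u2 x t)))
        - ∫ x in a..b, steklov u2 h x t * steklov v2 h x t) := by
    rw [← intervalIntegral.integral_sub
      ((by fun_prop : Continuous fun x =>
        steklov u2 h x t * (h⁻¹ * (u2 x (t + h) - u2 x t))).intervalIntegrable _ _)
      ((by fun_prop : Continuous fun x =>
        steklov u2 h x t * steklov v2 h x t).intervalIntegrable _ _),
      ← intervalIntegral.integral_const_mul]
    refine intervalIntegral.integral_congr_Ioo_of_le hab.le fun x hx => ?_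
    rw [← mul_steklov_eq hu2 hut hv hh dut eq hx ht]
    ring
  rw [e] at key
  have := nonpos_of_mul_nonpos_right key hε
  linarith

lemma integral_uxx_sq_le {a b ε : ℝ} (hab : a < b) (hε : 0 < ε)
    {u u1 u2 ut v v1 v2 : ℝ → ℝ → ℝ}
    (hu : Continuous (uncurry u)) (hu1 : Continuous (uncurry u1)) (hu2 : Continuous (uncurry u2))
    (hut : Continuous (uncurry ut)) (hv : Continuous (uncurry v)) (hv1 : Continuous (uncurry v1))
    (hv2 : Continuous (uncurry v2))
    (du0 : ∀ x ∈ Ioo a b, ∀ s > 0, HasDerivAt (fun y => u y s) (u1 x s) x)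
    (du1 : ∀ x ∈ Ioo a b, ∀ s > 0, HasDerivAt (fun y => u1 y s) (u2 x s) x)
    (dut : ∀ x ∈ Ioo a b, ∀ s > 0, HasDerivAt (u x) (ut x s) s)
    (dv0 : ∀ x ∈ Ioo a b, ∀ s > 0, HasDerivAt (fun y => v y s) (v1 x s) x)
    (dv1 : ∀ x ∈ Ioo a b, ∀ s > 0, HasDerivAt (fun y => v1 y s) (v2 x s) x)
    (eq : ∀ x ∈ Ioo a b, ∀ s > 0, ut x s = ε * u2 x s + v x s)
    (bu : ∀ s > 0, u a s = 0 ∧ u b s = 0) (bv : ∀ s > 0, v a s = 0 ∧ v b s = 0)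
    {T : ℝ} (hT : 0 < T) :
    (∫ x in a..b, (u2 x T) ^ 2) - ∫ x in a..b, (u2 x 0) ^ 2
      ≤ ∫ t in (0 : ℝ)..T, ∫ x in a..b, 2 * u2 x t * v2 x t := by
  have c3u := continuous_steklov hu2
  have c3v := continuous_steklov hv2
  have step : ∀ h > 0, (∫ x in a..b, (steklov u2 h x T) ^ 2) - (∫ x in a..b, (steklov u2 h x 0) ^ 2)
      ≤ ∫ t in (0 : ℝ)..T, 2 * ∫ x in a..b, steklov u2 h x t * steklov v2 h x t := by
    intro h hh
    have cW : Continuous (uncurry (steklov u2 h)) :=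
      c3u.comp (by fun_prop : Continuous fun p : ℝ × ℝ => (h, p.1, p.2))
    have cV : Continuous (uncurry (steklov v2 h)) :=
      c3v.comp (by fun_prop : Continuous fun p : ℝ × ℝ => (h, p.1, p.2))
    have cd : Continuous fun t => ∫ x in a..b,
        2 * steklov u2 h x t * (h⁻¹ * (u2 x (t + h) - u2 x t)) := by fun_prop
    rw [← intervalIntegral.integral_eq_sub_of_hasDerivAt_of_le hT.le
      (f := fun t => ∫ x in a..b, (steklov u2 h x t) ^ 2) (Continuous.continuousOn (by fun_prop))
      (fun t ht => hasDerivAt_integral_sq hab cW (by fun_prop) ht.1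
        fun x _ s _ => hasDerivAt_steklov_time hu2 hh x s) (cd.intervalIntegrable _ _)]
    refine intervalIntegral.integral_mono_on_of_le_Ioo hT.le (cd.intervalIntegrable _ _)
      (Continuous.intervalIntegrable (by fun_prop) _ _) fun t ht => ?_
    simp only [mul_assoc]
    rw [intervalIntegral.integral_const_mul]
    have := integral_steklov_mul_le hab hε hu hu1 hu2 hut hv hv1 hv2 du0 du1 dut dv0 dv1 eq bu bv
      hh ht.1
    linarith
  have lim : Continuous fun h =>
      (∫ t in (0 : ℝ)..T, 2 * ∫ x in a..b, steklov u2 h x t * steklov v2 h x t)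
      - ((∫ x in a..b, (steklov u2 h x T) ^ 2) - ∫ x in a..b, (steklov u2 h x 0) ^ 2) := by
    have i1 : Continuous fun q : (ℝ × ℝ) × ℝ => steklov u2 q.1.1 q.2 q.1.2 :=
      c3u.comp (by fun_prop : Continuous fun q : (ℝ × ℝ) × ℝ => (q.1.1, q.2, q.1.2))
    have i2 : Continuous fun q : (ℝ × ℝ) × ℝ => steklov v2 q.1.1 q.2 q.1.2 :=
      c3v.comp (by fun_prop : Continuous fun q : (ℝ × ℝ) × ℝ => (q.1.1, q.2, q.1.2))
    have i3 : ∀ t, Continuous fun q : ℝ × ℝ => steklov u2 q.1 q.2 t := fun t =>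
      c3u.comp (by fun_prop : Continuous fun q : ℝ × ℝ => (q.1, q.2, t))
    have j1 : Continuous (uncurry fun h t =>
        2 * ∫ x in a..b, steklov u2 h x t * steklov v2 h x t) :=
      continuous_const.mul (intervalIntegral.continuous_parametric_intervalIntegral_of_continuous'
        (f := fun (p : ℝ × ℝ) x => steklov u2 p.1 x p.2 * steklov v2 p.1 x p.2) (i1.mul i2) a b)
    refine (intervalIntegral.continuous_parametric_intervalIntegral_of_continuous' j1 0 T).sub
      (Continuous.sub ?_ ?_)
    · exact intervalIntegral.continuous_parametric_intervalIntegral_of_continuous'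
        (f := fun h x => (steklov u2 h x T) ^ 2) ((i3 T).fun_pow 2) a b
    · exact intervalIntegral.continuous_parametric_intervalIntegral_of_continuous'
        (f := fun h x => (steklov u2 h x 0) ^ 2) ((i3 0).fun_pow 2) a b
  have := ge_of_tendsto ((lim.tendsto 0).mono_left (nhdsWithin_le_nhds (s := Ioi 0)))
    (by filter_upwards [self_mem_nhdsWithin] with h hh using sub_nonneg.2 (step h hh))
  simp only [steklov_zero] at this
  simp only [mul_assoc, intervalIntegral.integral_const_mul] at this ⊢
  linarith

lemma sq_sub_le_integral_deriv_sq {a b : ℝ} {g g' : ℝ → ℝ} (hg : Continuous g)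
    (hg' : Continuous g') (d : ∀ x ∈ Ioo a b, HasDerivAt g (g' x) x) {x y : ℝ}
    (hx : x ∈ Icc a b) (hy : y ∈ Icc a b) :
    (g x - g y) ^ 2 ≤ (b - a) * ∫ z in a..b, (g' z) ^ 2 := by
  wlog hxy : y < x generalizing x y
  · rcases (not_lt.1 hxy).eq_or_lt with h | h
    · subst h
      have hab := hx.1.trans hx.2
      have : 0 ≤ ∫ z in a..b, (g' z) ^ 2 :=
        intervalIntegral.integral_nonneg hab fun z _ => sq_nonneg _
      have := mul_nonneg (sub_nonneg.2 hab) this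
      simpa using this
    · rw [← neg_sq, neg_sub]
      exact this hy hx h
  have hab : a < b := hy.1.trans_lt (hxy.trans_le hx.2)
  have i1 : ∀ c d, IntervalIntegrable g' volume c d := fun c d => hg'.intervalIntegrable _ _
  have i2 : ∀ c d, IntervalIntegrable (fun z => (g' z) ^ 2) volume c d :=
    fun c d => (hg'.pow 2).intervalIntegrable _ _
  have ftc : ∫ z in y..x, g' z = g x - g y :=
    intervalIntegral.integral_eq_sub_of_hasDerivAt_of_le hxy.le hg.continuousOn
      (fun z hz => d z ⟨hy.1.trans_lt hz.1, hz.2.trans_le hx.2⟩) (i1 _ _)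
  have hpos : 0 < x - y := sub_pos.2 hxy
  set m := (g x - g y) / (x - y) with hm
  have hmm : g x - g y = m * (x - y) := by rw [hm]; field_simp
  have h0 : 0 ≤ ∫ z in y..x, ((g' z) ^ 2 - 2 * m * g' z + m ^ 2) :=
    intervalIntegral.integral_nonneg hxy.le fun z _ => by nlinarith [sq_nonneg (g' z - m)]
  rw [intervalIntegral.integral_add ((i2 _ _).sub ((i1 _ _).const_mul _)) (by simp),
    intervalIntegral.integral_sub (i2 _ _) ((i1 _ _).const_mul _),
    intervalIntegral.integral_const_mul, ftc, hmm, intervalIntegral.integral_const,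
    smul_eq_mul] at h0
  have mono : ∫ z in y..x, (g' z) ^ 2 ≤ ∫ z in a..b, (g' z) ^ 2 :=
    intervalIntegral.integral_mono_interval hy.1 hxy.le hx.2
      (Eventually.of_forall fun z => sq_nonneg _) (i2 _ _)
  have h1 : m ^ 2 * (x - y) ≤ ∫ z in a..b, (g' z) ^ 2 := by linarith
  have hle : x - y ≤ b - a := by linarith [hx.2, hy.1]
  have h2 : 0 ≤ m ^ 2 * (x - y) := by positivity
  calc (g x - g y) ^ 2 = (x - y) * (m ^ 2 * (x - y)) := by rw [hmm]; ring
    _ ≤ (b - a) * (m ^ 2 * (x - y)) := by gcongr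
    _ ≤ _ := by gcongr

lemma sq_le_integral_sq_add {a b : ℝ} (hab : a < b) {g g' : ℝ → ℝ} (hg : Continuous g)
    (hg' : Continuous g') (d : ∀ x ∈ Ioo a b, HasDerivAt g (g' x) x) {x : ℝ}
    (hx : x ∈ Icc a b) :
    (g x) ^ 2 ≤ 2 / (b - a) * (∫ z in a..b, (g z) ^ 2)
      + 2 * (b - a) * ∫ z in a..b, (g' z) ^ 2 := by
  have hL : 0 < b - a := sub_pos.2 hab
  set D := ∫ z in a..b, (g' z) ^ 2
  have h : ∫ _ in a..b, (g x) ^ 2 ≤ ∫ y in a..b, (2 * (g y) ^ 2 + 2 * (b - a) * D) := by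
    refine intervalIntegral.integral_mono_on hab.le (by simp)
      (Continuous.intervalIntegrable (by fun_prop) _ _) fun y hy => ?_
    have := sq_sub_le_integral_deriv_sq hg hg' d hx hy
    nlinarith [sq_nonneg (g x - 2 * g y)]
  rw [intervalIntegral.integral_add (Continuous.intervalIntegrable (by fun_prop) _ _) (by simp),
    intervalIntegral.integral_const_mul, intervalIntegral.integral_const,
    intervalIntegral.integral_const, smul_eq_mul, smul_eq_mul] at h
  refine le_of_mul_le_mul_left (h.trans_eq ?_) hL
  field_simp

lemma young_bound {A B P th F F1 F2 M k S : ℝ} (hM : 0 ≤ M) (hk : 0 ≤ k) (hB : |B| ≤ k)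
    (hth : 0 ≤ th) (hS : th ^ 2 ≤ S) (hF : |F| ≤ M * th) (hF1 : |F1| ≤ M) (hF2 : |F2| ≤ M) :
    -((F2 * B * B + F1 * A) * P) - A ^ 2 + F * P * A - B ^ 2 - th * F * P
      ≤ -(3 / 4) * A ^ 2 + M * k / 2 * B ^ 2
        + (M * k / 2 + 2 * M ^ 2 + 2 * M ^ 2 * S + M * S / 2) * P ^ 2 + M / 2 * th ^ 2 := by
  have h1 : -(F2 * B * B * P) ≤ M * k / 2 * (B ^ 2 + P ^ 2) := by
    have e : |F2 * B * B * P| = |F2| * (|B| * (|B| * |P|)) := by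
      simp only [abs_mul]; ring
    have hBP : |B| * |P| ≤ (B ^ 2 + P ^ 2) / 2 := by
      nlinarith [sq_nonneg (|B| - |P|), sq_abs B, sq_abs P]
    calc -(F2 * B * B * P) ≤ |F2 * B * B * P| := neg_le_abs _
      _ = |F2| * (|B| * (|B| * |P|)) := e
      _ ≤ M * (k * ((B ^ 2 + P ^ 2) / 2)) := by gcongr
      _ = _ := by ring
  have h2 : -(F1 * A * P) ≤ A ^ 2 / 8 + 2 * M ^ 2 * P ^ 2 := by
    have : F1 ^ 2 ≤ M ^ 2 := sq_le_sq' (abs_le.1 hF1).1 (abs_le.1 hF1).2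
    nlinarith [sq_nonneg (A / 2 + 2 * F1 * P), mul_le_mul_of_nonneg_right this (sq_nonneg P)]
  have h3 : F * P * A ≤ A ^ 2 / 8 + 2 * M ^ 2 * S * P ^ 2 := by
    have hF' : F ^ 2 ≤ (M * th) ^ 2 := sq_le_sq' (abs_le.1 hF).1 (abs_le.1 hF).2
    have : F ^ 2 ≤ M ^ 2 * S := by
      rw [mul_pow] at hF'
      exact hF'.trans (by gcongr)
    nlinarith [sq_nonneg (A / 2 - 2 * F * P), mul_le_mul_of_nonneg_right this (sq_nonneg P)]
  have h4 : -(th * F * P) ≤ M / 2 * th ^ 2 + M * S / 2 * P ^ 2 := by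
    have e : |th * F * P| = th * |F| * |P| := by simp only [abs_mul, abs_of_nonneg hth]
    have hP : |P| ≤ (1 + P ^ 2) / 2 := by nlinarith [sq_nonneg (|P| - 1), sq_abs P]
    calc -(th * F * P) ≤ |th * F * P| := neg_le_abs _
      _ = th * |F| * |P| := e
      _ ≤ th * (M * th) * ((1 + P ^ 2) / 2) := by gcongr
      _ = M / 2 * th ^ 2 + M / 2 * (th ^ 2 * P ^ 2) := by ring
      _ ≤ M / 2 * th ^ 2 + M / 2 * (S * P ^ 2) := by gcongr
      _ = _ := by ring
  nlinarith [sq_nonneg B]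

/-- Constant in the differential inequality `Y' + ½ ∫ Θ_xx² ≤ C (1 + Y²)`. -/
def energyConst (L M : ℝ) : ℝ :=
  M ^ 2 * L + 4 * M ^ 2 + 4 * M ^ 2 * (4 / L + 4 * L) + M + M * (4 / L + 4 * L)

lemma energyConst_nonneg {L M : ℝ} (hL : 0 < L) (hM : 0 ≤ M) : 0 ≤ energyConst L M := by
  unfold energyConst
  positivity

lemma energy_rate_le {a b M Y : ℝ} (hab : a < b) (hM : 0 ≤ M)
    {th th1 th2 p p1 F F1 F2 : ℝ → ℝ} (cth : Continuous th) (cth1 : Continuous th1)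
    (cth2 : Continuous th2) (cp : Continuous p) (cp1 : Continuous p1) (cF : Continuous F)
    (cF1 : Continuous F1) (cF2 : Continuous F2)
    (dth : ∀ x ∈ Ioo a b, HasDerivAt th (th1 x) x)
    (dth1 : ∀ x ∈ Ioo a b, HasDerivAt th1 (th2 x) x)
    (dp : ∀ x ∈ Ioo a b, HasDerivAt p (p1 x) x)
    (dF1 : ∀ x ∈ Ioo a b, HasDerivAt F1 (F2 x * th1 x) x)
    (bth : th1 a = 0 ∧ th1 b = 0) (pos : ∀ x, 0 ≤ th x)
    (hF : ∀ x, |F x| ≤ M * th x) (hF1 : ∀ x, |F1 x| ≤ M) (hF2 : ∀ x, |F2 x| ≤ M)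
    (hY : (∫ x in a..b, (p x) ^ 2) + (∫ x in a..b, (th1 x) ^ 2) + (∫ x in a..b, (th x) ^ 2)
      ≤ 2 * Y) :
    (∫ x in a..b, F1 x * th1 x * p1 x) - (∫ x in a..b, (th2 x - F x * p x) * th2 x)
        + (∫ x in a..b, th x * (th2 x - F x * p x))
      ≤ energyConst (b - a) M * (1 + Y ^ 2) - 1 / 2 * ∫ x in a..b, (th2 x) ^ 2 := by
  have hL : 0 < b - a := sub_pos.2 hab
  have ii : ∀ {g : ℝ → ℝ}, Continuous g → IntervalIntegrable g volume a b :=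
    fun hg => hg.intervalIntegrable _ _
  have ibp1 := integral_mul_deriv_of_Ioo hab (g := fun x => F1 x * th1 x)
    (g' := fun x => F2 x * th1 x * th1 x + F1 x * th2 x) (by fun_prop) (by fun_prop) cp cp1
    (fun x hx => (dF1 x hx).mul (dth1 x hx)) dp
  have ibp2 := integral_mul_deriv_of_Ioo hab cth cth1 cth1 cth2 dth dth1
  simp only [bth.1, bth.2, mul_zero, zero_mul, sub_self, zero_sub] at ibp1 ibp2
  have nn : ∀ g : ℝ → ℝ, 0 ≤ ∫ x in a..b, (g x) ^ 2 := fun g =>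
    intervalIntegral.integral_nonneg hab.le fun x _ => sq_nonneg _
  set E1 := ∫ x in a..b, (p x) ^ 2
  set E2 := ∫ x in a..b, (th1 x) ^ 2
  set E3 := ∫ x in a..b, (th x) ^ 2
  set D := ∫ x in a..b, (th2 x) ^ 2
  have hE1 : 0 ≤ E1 := nn p
  have hE2 : 0 ≤ E2 := nn th1
  have hE3 : 0 ≤ E3 := nn th
  have hD : 0 ≤ D := nn th2
  have hY0 : 0 ≤ Y := by linarith
  set k := √((b - a) * D)
  have hk : 0 ≤ k := Real.sqrt_nonneg _
  have hk2 : k ^ 2 = (b - a) * D := Real.sq_sqrt (by positivity)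
  set c := 4 / (b - a) + 4 * (b - a) with hc
  have hc0 : 0 ≤ c := by positivity
  have hB : ∀ x ∈ Ioo a b, |th1 x| ≤ k := by
    intro x hx
    refine Real.abs_le_sqrt ?_
    simpa [bth.1] using sq_sub_le_integral_deriv_sq cth1 cth2 dth1 (Ioo_subset_Icc_self hx)
      (left_mem_Icc.2 hab.le)
  have hS : ∀ x ∈ Ioo a b, (th x) ^ 2 ≤ c * Y := by
    intro x hx
    refine (sq_le_integral_sq_add hab cth cth1 dth (Ioo_subset_Icc_self hx)).trans ?_
    have h1 : 2 / (b - a) * E3 ≤ 2 / (b - a) * (2 * Y) := by gcongr; linarith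
    have h2 : 2 * (b - a) * E2 ≤ 2 * (b - a) * (2 * Y) := by gcongr; linarith
    calc _ ≤ 2 / (b - a) * (2 * Y) + 2 * (b - a) * (2 * Y) := add_le_add h1 h2
      _ = c * Y := by rw [hc]; ring
  set S := c * Y with hSdef
  have split : (∫ x in a..b, F1 x * th1 x * p1 x) - (∫ x in a..b, (th2 x - F x * p x) * th2 x)
        + (∫ x in a..b, th x * (th2 x - F x * p x))
      = ∫ x in a..b, (-((F2 x * th1 x * th1 x + F1 x * th2 x) * p x) - (th2 x) ^ 2
          + F x * p x * th2 x - (th1 x) ^ 2 - th x * F x * p x) := by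
    have e3 : ∫ x in a..b, th x * (th2 x - F x * p x)
        = (∫ x in a..b, th x * th2 x) - ∫ x in a..b, th x * F x * p x := by
      rw [← intervalIntegral.integral_sub (ii (by fun_prop)) (ii (by fun_prop))]
      congr 1; ext x; ring
    rw [e3, ibp1, ibp2, ← intervalIntegral.integral_neg,
      ← intervalIntegral.integral_neg, ← intervalIntegral.integral_sub (ii (by fun_prop))
      (ii (by fun_prop)), ← intervalIntegral.integral_sub (ii (by fun_prop))
      (ii (by fun_prop)), ← intervalIntegral.integral_add (ii (by fun_prop)) (ii (by fun_prop))]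
    congr 1; ext x; ring
  have mono : ∫ x in a..b, (-((F2 x * th1 x * th1 x + F1 x * th2 x) * p x) - (th2 x) ^ 2
          + F x * p x * th2 x - (th1 x) ^ 2 - th x * F x * p x)
      ≤ ∫ x in a..b, (-(3 / 4) * (th2 x) ^ 2 + M * k / 2 * (th1 x) ^ 2
        + (M * k / 2 + 2 * M ^ 2 + 2 * M ^ 2 * S + M * S / 2) * (p x) ^ 2
        + M / 2 * (th x) ^ 2) :=
    intervalIntegral.integral_mono_on_of_le_Ioo hab.le (ii (by fun_prop)) (ii (by fun_prop))
      fun x hx => young_bound hM hk (hB x hx) (pos x) (hS x hx) (hF x) (hF1 x) (hF2 x)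
  rw [intervalIntegral.integral_add (ii (by fun_prop)) (ii (by fun_prop)),
    intervalIntegral.integral_add (ii (by fun_prop)) (ii (by fun_prop)),
    intervalIntegral.integral_add (ii (by fun_prop)) (ii (by fun_prop))] at mono
  simp only [intervalIntegral.integral_const_mul] at mono
  rw [split]
  refine mono.trans ?_
  have b1 : M * k / 2 * E2 + M * k / 2 * E1 ≤ D / 4 + M ^ 2 * (b - a) * Y ^ 2 := by
    have h1 : M * k / 2 * (E2 + E1) ≤ M * k / 2 * (2 * Y) := by gcongr; linarith
    have h2 : M * k * Y ≤ D / 4 + M ^ 2 * (b - a) * Y ^ 2 := by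
      have h3 : 0 ≤ (k - 2 * (b - a) * M * Y) ^ 2 := sq_nonneg _
      refine le_of_mul_le_mul_left ?_ hL
      nlinarith
    linarith
  have b2 : (2 * M ^ 2 + 2 * M ^ 2 * S + M * S / 2) * E1
      ≤ (2 * M ^ 2 + 2 * M ^ 2 * S + M * S / 2) * (2 * Y) := by
    have : 0 ≤ S := by positivity
    gcongr; linarith
  have b3 : M / 2 * E3 ≤ M / 2 * (2 * Y) := by gcongr; linarith
  have b4 : (4 * M ^ 2 + M) * Y ≤ (4 * M ^ 2 + M) * (1 + Y ^ 2) := by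
    gcongr; nlinarith [sq_nonneg (Y - 1)]
  have b5 : 0 ≤ M ^ 2 * (b - a) + 4 * M ^ 2 * c + M * c := by positivity
  unfold energyConst
  rw [hSdef] at b2 ⊢
  nlinarith

lemma quadratic_gronwall {Y D : ℝ → ℝ} (hY : Continuous Y)
    (hY0 : ∀ t, 0 ≤ Y t) (hD0 : ∀ t, 0 ≤ D t) {C τ θ : ℝ} (hC : 0 ≤ C) (hτ : 0 < τ)
    (hθ : Real.arctan (Y 0) + C * τ = θ) (hθπ : θ < Real.pi / 2)
    (h : ∀ T > 0, Y T + 1 / 2 * (∫ t in (0 : ℝ)..T, D t)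
      ≤ Y 0 + ∫ t in (0 : ℝ)..T, C * (1 + (Y t) ^ 2)) :
    (∀ t ∈ Ioc 0 τ, Y t ≤ Real.tan θ) ∧
      ∫ t in (0 : ℝ)..τ, D t ≤ 2 * (Y 0 + C * τ * (1 + Real.tan θ ^ 2)) := by
  set Z : ℝ → ℝ := fun T => Y 0 + ∫ t in (0 : ℝ)..T, C * (1 + (Y t) ^ 2) with hZ
  have cg : Continuous fun t => C * (1 + (Y t) ^ 2) := by fun_prop
  have dZ : ∀ t, HasDerivAt Z (C * (1 + (Y t) ^ 2)) t := fun t =>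
    (cg.integral_hasStrictDerivAt 0 t).hasDerivAt.const_add _
  have YZ : ∀ T > 0, Y T ≤ Z T := by
    intro T hT
    have : 0 ≤ ∫ t in (0 : ℝ)..T, D t :=
      intervalIntegral.integral_nonneg hT.le fun t _ => hD0 t
    have := h T hT
    simp only [hZ]
    linarith
  have dA : ∀ t, HasDerivAt (fun t => Real.arctan (Z t) - C * t)
      (1 / (1 + Z t ^ 2) * (C * (1 + (Y t) ^ 2)) - C * 1) t := fun t =>
    (dZ t).arctan.sub ((hasDerivAt_id t).const_mul C)
  have anti : AntitoneOn (fun t => Real.arctan (Z t) - C * t) (Ici 0) := by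
    refine antitoneOn_of_deriv_nonpos (convex_Ici 0)
      (fun t _ => (dA t).continuousAt.continuousWithinAt)
      (fun t _ => (dA t).differentiableAt.differentiableWithinAt) fun t ht => ?_
    rw [interior_Ici] at ht
    rw [(dA t).deriv, mul_one, sub_nonpos, one_div, ← div_eq_inv_mul, div_le_iff₀ (by positivity)]
    have := YZ t ht
    have := hY0 t
    gcongr
  have Z0 : Z 0 = Y 0 := by simp [hZ]
  have bound : ∀ t ∈ Ioc 0 τ, Y t ≤ Real.tan θ := by
    intro t ht
    have h1 : Real.arctan (Z t) - C * t ≤ Real.arctan (Z 0) - C * 0 :=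
      anti self_mem_Ici ht.1.le ht.1.le
    have h2 : C * t ≤ C * τ := by gcongr; exact ht.2
    rw [Z0] at h1
    have h3 : Real.arctan (Z t) ≤ θ := by linarith
    refine (YZ t ht.1).trans ?_
    rw [← Real.tan_arctan (Z t)]
    rcases h3.eq_or_lt with e | l
    · rw [e]
    · exact (Real.tan_lt_tan_of_lt_of_lt_pi_div_two (Real.neg_pi_div_two_lt_arctan _) hθπ l).le
  refine ⟨bound, ?_⟩
  have h1 := h τ hτ
  have h2 : ∫ t in (0 : ℝ)..τ, C * (1 + (Y t) ^ 2)
      ≤ ∫ _ in (0 : ℝ)..τ, C * (1 + Real.tan θ ^ 2) := by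
    refine intervalIntegral.integral_mono_on_of_le_Ioo hτ.le (cg.intervalIntegrable _ _) (by simp)
      fun t ht => ?_
    have := bound t (Ioo_subset_Ioc_self ht)
    have := hY0 t
    gcongr
  rw [intervalIntegral.integral_const, smul_eq_mul] at h2
  have := hY0 τ
  linarith

lemma HypF.hasDerivAt_f {f f' f'' : ℝ → ℝ} (hf : HypF f f' f'') {x : ℝ} (hx : 0 < x) :
    HasDerivAt f (f' x) x :=
  (hf.hasDeriv₁ x hx.le).hasDerivAt (Ici_mem_nhds hx)

lemma HypF.hasDerivAt_f' {f f' f'' : ℝ → ℝ} (hf : HypF f f' f'') {x : ℝ} (hx : 0 < x) :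
    HasDerivAt f' (f'' x) x :=
  (hf.hasDeriv₂ x hx.le).hasDerivAt (Ici_mem_nhds hx)

lemma HypF.abs_le {f f' f'' : ℝ → ℝ} (hf : HypF f f' f'') {M : ℝ}
    (hM : ∀ x ∈ Ici (0 : ℝ), |f' x| ≤ M ∧ |f'' x| ≤ M) {x : ℝ} (hx : 0 ≤ x) :
    |f x| ≤ M * x := by
  have := (convex_Ici (0 : ℝ)).norm_image_sub_le_of_norm_hasDerivWithin_le (x := 0) (y := x)
    hf.hasDeriv₁ (fun y hy => (hM y hy).1) self_mem_Ici hx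
  simpa [hf.zero, abs_of_nonneg hx] using this

/-- A solution of the regularized problem extended to continuous functions on `ℝ × ℝ`; the `k`-th
space derivative of each component is recorded as the `k`-th entry of a sequence. -/
structure ExtendedSol (a b ε : ℝ) (f f' : ℝ → ℝ) (v u θ : ℕ → ℝ → ℝ → ℝ)
    (vt ut θt : ℝ → ℝ → ℝ) : Prop where
  cv : ∀ k ≤ 4, Continuous (uncurry (v k))
  cu : ∀ k ≤ 2, Continuous (uncurry (u k))
  cθ : ∀ k ≤ 2, Continuous (uncurry (θ k))
  cvt : Continuous (uncurry vt)
  cut : Continuous (uncurry ut)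
  cθt : Continuous (uncurry θt)
  dv : ∀ k < 4, ∀ x ∈ Ioo a b, ∀ s > 0, HasDerivAt (fun y => v k y s) (v (k + 1) x s) x
  du : ∀ k < 2, ∀ x ∈ Ioo a b, ∀ s > 0, HasDerivAt (fun y => u k y s) (u (k + 1) x s) x
  dθ : ∀ k < 2, ∀ x ∈ Ioo a b, ∀ s > 0, HasDerivAt (fun y => θ k y s) (θ (k + 1) x s) x
  dvt : ∀ x ∈ Ioo a b, ∀ s > 0, HasDerivAt (v 0 x) (vt x s) s
  dut : ∀ x ∈ Ioo a b, ∀ s > 0, HasDerivAt (u 0 x) (ut x s) s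
  dθt : ∀ x ∈ Ioo a b, ∀ s > 0, HasDerivAt (θ 0 x) (θt x s) s
  pos : ∀ x s, 0 < θ 0 x s
  eqv : ∀ x ∈ Ioo a b, ∀ s > 0,
    vt x s = -ε * v 4 x s + u 2 x s - f' (θ 0 x s) * θ 1 x s
  equ : ∀ x ∈ Ioo a b, ∀ s > 0, ut x s = ε * u 2 x s + v 0 x s
  eqθ : ∀ x ∈ Ioo a b, ∀ s > 0, θt x s = θ 2 x s - f (θ 0 x s) * v 1 x s
  bv0 : ∀ s > 0, v 0 a s = 0 ∧ v 0 b s = 0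
  bv2 : ∀ s > 0, v 2 a s = 0 ∧ v 2 b s = 0
  bu : ∀ s > 0, u 0 a s = 0 ∧ u 0 b s = 0
  bθ : ∀ s > 0, θ 1 a s = 0 ∧ θ 1 b s = 0

/-- The energy `½ ∫ (v_x² + u_xx² + Θ_x² + Θ²)`. -/
def energy (a b : ℝ) (v u θ : ℕ → ℝ → ℝ → ℝ) (t : ℝ) : ℝ :=
  1 / 2 * ((∫ x in a..b, (v 1 x t) ^ 2) + (∫ x in a..b, (u 2 x t) ^ 2)
    + (∫ x in a..b, (θ 1 x t) ^ 2) + ∫ x in a..b, (θ 0 x t) ^ 2)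

namespace ExtendedSol

variable {a b ε : ℝ} {f f' f'' : ℝ → ℝ} {v u θ : ℕ → ℝ → ℝ → ℝ} {vt ut θt : ℝ → ℝ → ℝ}

lemma continuous_energy (h : ExtendedSol a b ε f f' v u θ vt ut θt) :
    Continuous (energy a b v u θ) := by
  have := h.cv 1 (by norm_num)
  have := h.cu 2 le_rfl
  have := h.cθ 1 (by norm_num)
  have := h.cθ 0 (by norm_num)
  unfold energy
  fun_prop

lemma rate_le (h : ExtendedSol a b ε f f' v u θ vt ut θt) (hab : a < b) (hε : 0 < ε)
    (hf : HypF f f' f'') {M : ℝ} (hM : ∀ x ∈ Ici (0 : ℝ), |f' x| ≤ M ∧ |f'' x| ≤ M)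
    {t : ℝ} (ht : 0 < t) :
    -(∫ x in a..b, 2 * vt x t * v 2 x t) + (∫ x in a..b, 2 * u 2 x t * v 2 x t)
      - (∫ x in a..b, 2 * θt x t * θ 2 x t) + (∫ x in a..b, 2 * θ 0 x t * θt x t)
      ≤ 2 * (energyConst (b - a) M * (1 + (energy a b v u θ t) ^ 2)
          - 1 / 2 * ∫ x in a..b, (θ 2 x t) ^ 2) := by
  have sl : ∀ {F : ℝ → ℝ → ℝ}, Continuous (uncurry F) → Continuous fun x => F x t :=
    fun hF => by fun_prop
  have cv1 := sl (h.cv 1 (by norm_num))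
  have cv2 := sl (h.cv 2 (by norm_num))
  have cv3 := sl (h.cv 3 (by norm_num))
  have cv4 := sl (h.cv 4 le_rfl)
  have cu2 := sl (h.cu 2 le_rfl)
  have cθ0 := sl (h.cθ 0 (by norm_num))
  have cθ1 := sl (h.cθ 1 (by norm_num))
  have cθ2 := sl (h.cθ 2 le_rfl)
  have cF : Continuous fun x => f (θ 0 x t) :=
    ContinuousOn.comp_continuous (s := Ici 0)
      (fun x hx => (hf.hasDeriv₁ x hx).continuousWithinAt) cθ0 fun x => (h.pos x t).le
  have cF1 : Continuous fun x => f' (θ 0 x t) :=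
    ContinuousOn.comp_continuous (s := Ici 0)
      (fun x hx => (hf.hasDeriv₂ x hx).continuousWithinAt) cθ0 fun x => (h.pos x t).le
  have cF2 : Continuous fun x => f'' (θ 0 x t) :=
    hf.cont₂.comp_continuous cθ0 fun x => (h.pos x t).le
  have hM0 : 0 ≤ M := (abs_nonneg _).trans (hM 0 self_mem_Ici).1
  have ii : ∀ {g : ℝ → ℝ}, Continuous g → IntervalIntegrable g volume a b :=
    fun hg => hg.intervalIntegrable _ _
  have hu : 0 ≤ ∫ x in a..b, (u 2 x t) ^ 2 :=
    intervalIntegral.integral_nonneg hab.le fun x _ => sq_nonneg _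
  have main := energy_rate_le (Y := energy a b v u θ t) hab hM0 cθ0 cθ1 cθ2 cv1 cv2 cF cF1 cF2
    (fun x hx => h.dθ 0 (by norm_num) x hx t ht) (fun x hx => h.dθ 1 (by norm_num) x hx t ht)
    (fun x hx => h.dv 1 (by norm_num) x hx t ht)
    (fun x hx => HasDerivAt.comp x (hf.hasDerivAt_f' (h.pos x t))
      (h.dθ 0 (by norm_num) x hx t ht))
    (h.bθ t ht) (fun x => (h.pos x t).le) (fun x => hf.abs_le hM (h.pos x t).le)
    (fun x => (hM _ (h.pos x t).le).1) (fun x => (hM _ (h.pos x t).le).2)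
    (by unfold energy; linarith)
  have visc := integral_mul_deriv2_nonpos hab cv2 cv3 cv4
    (fun x hx => h.dv 2 (by norm_num) x hx t ht) (fun x hx => h.dv 3 (by norm_num) x hx t ht)
    (h.bv2 t ht).1 (h.bv2 t ht).2
  have ev : ∫ x in a..b, 2 * vt x t * v 2 x t
      = 2 * (-ε * (∫ x in a..b, v 2 x t * v 4 x t) - ∫ x in a..b, f' (θ 0 x t) * θ 1 x t * v 2 x t)
        + ∫ x in a..b, 2 * u 2 x t * v 2 x t := by
    have c24 : Continuous fun x => -ε * (v 2 x t * v 4 x t) :=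
      continuous_const.mul (cv2.mul cv4)
    have cdiff : Continuous fun x =>
        2 * (-ε * (v 2 x t * v 4 x t) - f' (θ 0 x t) * θ 1 x t * v 2 x t) :=
      continuous_const.mul (c24.sub ((cF1.mul cθ1).mul cv2))
    have c2 : Continuous fun x => 2 * u 2 x t * v 2 x t := by fun_prop
    have cF1v : Continuous fun x => f' (θ 0 x t) * θ 1 x t * v 2 x t := (cF1.mul cθ1).mul cv2
    rw [← intervalIntegral.integral_const_mul,
      ← intervalIntegral.integral_sub (ii c24) (ii cF1v),
      ← intervalIntegral.integral_const_mul,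
      ← intervalIntegral.integral_add (ii cdiff) (ii c2)]
    refine intervalIntegral.integral_congr_Ioo_of_le hab.le fun x hx => ?_
    simp only [h.eqv x hx t ht]
    ring
  have e1 : ∫ x in a..b, 2 * θt x t * θ 2 x t
      = 2 * ∫ x in a..b, (θ 2 x t - f (θ 0 x t) * v 1 x t) * θ 2 x t := by
    rw [← intervalIntegral.integral_const_mul]
    refine intervalIntegral.integral_congr_Ioo_of_le hab.le fun x hx => ?_
    simp only [h.eqθ x hx t ht]
    ring
  have e2 : ∫ x in a..b, 2 * θ 0 x t * θt x t
      = 2 * ∫ x in a..b, θ 0 x t * (θ 2 x t - f (θ 0 x t) * v 1 x t) := by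
    rw [← intervalIntegral.integral_const_mul]
    refine intervalIntegral.integral_congr_Ioo_of_le hab.le fun x hx => ?_
    simp only [h.eqθ x hx t ht]
    ring
  have hneg := mul_nonpos_of_nonneg_of_nonpos hε.le visc
  rw [ev, e1, e2]
  linarith

lemma energy_le (h : ExtendedSol a b ε f f' v u θ vt ut θt) (hab : a < b) (hε : 0 < ε)
    (hf : HypF f f' f'') {M : ℝ} (hM : ∀ x ∈ Ici (0 : ℝ), |f' x| ≤ M ∧ |f'' x| ≤ M)
    {T : ℝ} (hT : 0 < T) :
    energy a b v u θ T + 1 / 2 * (∫ t in (0 : ℝ)..T, ∫ x in a..b, (θ 2 x t) ^ 2)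
      ≤ energy a b v u θ 0
        + ∫ t in (0 : ℝ)..T, energyConst (b - a) M * (1 + (energy a b v u θ t) ^ 2) := by
  have cv0 := h.cv 0 (by norm_num)
  have cv1 := h.cv 1 (by norm_num)
  have cv2 := h.cv 2 (by norm_num)
  have cu2 := h.cu 2 le_rfl
  have cθ0 := h.cθ 0 (by norm_num)
  have cθ1 := h.cθ 1 (by norm_num)
  have cθ2 := h.cθ 2 le_rfl
  have cvt := h.cvt
  have cθt := h.cθt
  have cE := h.continuous_energy
  have ii : ∀ {g : ℝ → ℝ}, Continuous g → IntervalIntegrable g volume 0 T :=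
    fun hg => hg.intervalIntegrable _ _
  have iv := intervalIntegral.integral_eq_sub_of_hasDerivAt_of_le hT.le
    (f := fun t => ∫ x in a..b, (v 1 x t) ^ 2) (Continuous.continuousOn (by fun_prop))
    (fun t ht => hasDerivAt_integral_deriv_sq hab cv0 cv1 cv2 cvt ht.1 (h.dv 0 (by norm_num))
      (h.dv 1 (by norm_num)) h.dvt (fun s hs r hr => by simp [(h.bv0 s hs).1, (h.bv0 r hr).1])
      (fun s hs r hr => by simp [(h.bv0 s hs).2, (h.bv0 r hr).2])) (ii (by fun_prop))
  have iθ1 := intervalIntegral.integral_eq_sub_of_hasDerivAt_of_le hT.le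
    (f := fun t => ∫ x in a..b, (θ 1 x t) ^ 2) (Continuous.continuousOn (by fun_prop))
    (fun t ht => hasDerivAt_integral_deriv_sq hab cθ0 cθ1 cθ2 cθt ht.1 (h.dθ 0 (by norm_num))
      (h.dθ 1 (by norm_num)) h.dθt (fun s hs r hr => by simp [(h.bθ s hs).1, (h.bθ r hr).1])
      (fun s hs r hr => by simp [(h.bθ s hs).2, (h.bθ r hr).2])) (ii (by fun_prop))
  have iθ0 := intervalIntegral.integral_eq_sub_of_hasDerivAt_of_le hT.le
    (f := fun t => ∫ x in a..b, (θ 0 x t) ^ 2) (Continuous.continuousOn (by fun_prop))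
    (fun t ht => hasDerivAt_integral_sq hab cθ0 cθt ht.1 h.dθt) (ii (by fun_prop))
  have iu := integral_uxx_sq_le hab hε (h.cu 0 (by norm_num)) (h.cu 1 (by norm_num)) cu2 h.cut
    cv0 cv1 cv2 (h.du 0 (by norm_num)) (h.du 1 (by norm_num)) h.dut (h.dv 0 (by norm_num))
    (h.dv 1 (by norm_num)) h.equ h.bu h.bv0 hT
  have mono := intervalIntegral.integral_mono_on_of_le_Ioo (μ := volume) hT.le
    (f := fun t => -(∫ x in a..b, 2 * vt x t * v 2 x t) + (∫ x in a..b, 2 * u 2 x t * v 2 x t)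
      - (∫ x in a..b, 2 * θt x t * θ 2 x t) + (∫ x in a..b, 2 * θ 0 x t * θt x t))
    (g := fun t => 2 * (energyConst (b - a) M * (1 + (energy a b v u θ t) ^ 2)
          - 1 / 2 * ∫ x in a..b, (θ 2 x t) ^ 2))
    (ii (by fun_prop)) (ii (by fun_prop)) fun t ht => h.rate_le hab hε hf hM ht.1
  rw [intervalIntegral.integral_add (ii (by fun_prop)) (ii (by fun_prop)),
    intervalIntegral.integral_sub (ii (by fun_prop)) (ii (by fun_prop)),
    intervalIntegral.integral_add (ii (by fun_prop)) (ii (by fun_prop)),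
    intervalIntegral.integral_const_mul,
    intervalIntegral.integral_sub (ii (by fun_prop)) (ii (by fun_prop)),
    intervalIntegral.integral_const_mul (1 / 2 : ℝ)] at mono
  rw [intervalIntegral.integral_neg] at iv iθ1 mono
  simp only [energy] at mono ⊢
  linarith

end ExtendedSol

/-- Constant extension of `F` from `[a, b] × [0, ∞)` to `ℝ × ℝ`. -/
def clampExt (a b : ℝ) (F : ℝ → ℝ → ℝ) : ℝ → ℝ → ℝ :=
  fun x t => F (max a (min b x)) (max 0 t)

lemma clampExt_eq {a b : ℝ} (F : ℝ → ℝ → ℝ) {x t : ℝ} (hx : x ∈ Icc a b) (ht : 0 ≤ t) :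
    clampExt a b F x t = F x t := by
  simp [clampExt, min_eq_right hx.2, max_eq_right hx.1, max_eq_right ht]

lemma clampExt_mem {a b : ℝ} (hab : a < b) (x : ℝ) : max a (min b x) ∈ Icc a b :=
  ⟨le_max_left _ _, max_le hab.le (min_le_left _ _)⟩

lemma continuous_clampExt {a b : ℝ} (hab : a < b) {F : ℝ → ℝ → ℝ}
    (hF : ContinuousOn (uncurry F) ((Icc a b) ×ˢ (Ici 0))) :
    Continuous (uncurry (clampExt a b F)) :=
  hF.comp_continuous (f := fun p : ℝ × ℝ => (max a (min b p.1), max 0 p.2)) (by fun_prop)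
    fun _ => ⟨clampExt_mem hab _, mem_Ici.2 (le_max_left _ _)⟩

lemma hasDerivAt_clampExt_space {a b : ℝ} {F : ℝ → ℝ → ℝ} {x t d : ℝ} (hx : x ∈ Ioo a b)
    (ht : 0 ≤ t) (h : HasDerivAt (fun y => F y t) d x) :
    HasDerivAt (fun y => clampExt a b F y t) d x := by
  refine h.congr_of_eventuallyEq ?_
  filter_upwards [Ioo_mem_nhds hx.1 hx.2] with y hy
  exact clampExt_eq F (Ioo_subset_Icc_self hy) ht

lemma hasDerivAt_clampExt_time {a b : ℝ} {F : ℝ → ℝ → ℝ} {x t d : ℝ} (hx : x ∈ Ioo a b)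
    (ht : 0 < t) (h : HasDerivAt (F x) d t) : HasDerivAt (clampExt a b F x) d t := by
  refine h.congr_of_eventuallyEq ?_
  filter_upwards [Ioi_mem_nhds ht] with s hs
  exact clampExt_eq F (Ioo_subset_Icc_self hx) (le_of_lt hs)

lemma hasDerivAt_pdx_iterate {w : ℝ → ℝ → ℝ} {k : ℕ} {x t : ℝ}
    (h : DifferentiableAt ℝ (fun y => pdx^[k] w y t) x) :
    HasDerivAt (fun y => pdx^[k] w y t) (pdx^[k + 1] w x t) x := by
  rw [Function.iterate_succ_apply']
  exact h.hasDerivAt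

lemma IsClassicalSolEps.extendedSol {a b ε : ℝ} (hab : a < b) {f f' f'' : ℝ → ℝ}
    (hf : HypF f f' f'') {v0 u0 Θ0 : ℝ → ℝ} {v u Θ : ℝ → ℝ → ℝ}
    (h : IsClassicalSolEps a b f ε v0 u0 Θ0 v u Θ) :
    ExtendedSol a b ε f f' (fun k => clampExt a b (pdx^[k] v)) (fun k => clampExt a b (pdx^[k] u))
      (fun k => clampExt a b (pdx^[k] Θ)) (clampExt a b (pdt v)) (clampExt a b (pdt u))
      (clampExt a b (pdt Θ)) := by
  have sub : ∀ {x}, x ∈ Ioo a b → x ∈ Icc a b := fun hx => Ioo_subset_Icc_self hx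
  have ha : a ∈ Icc a b := left_mem_Icc.2 hab.le
  have hb : b ∈ Icc a b := right_mem_Icc.2 hab.le
  refine
    { cv := fun k hk => continuous_clampExt hab (h.cont_v k hk)
      cu := fun k hk => continuous_clampExt hab (h.cont_u k hk)
      cθ := fun k hk => continuous_clampExt hab (h.cont_Θ k hk)
      cvt := continuous_clampExt hab h.contt_v
      cut := continuous_clampExt hab h.contt_u
      cθt := continuous_clampExt hab h.contt_Θ
      dv := fun k hk x hx s hs => ?_
      du := fun k hk x hx s hs => ?_
      dθ := fun k hk x hx s hs => ?_
      dvt := fun x hx s hs => ?_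
      dut := fun x hx s hs => ?_
      dθt := fun x hx s hs => ?_
      pos := fun x s => h.Θ_pos _ (clampExt_mem hab x) _ (mem_Ici.2 (le_max_left _ _))
      eqv := fun x hx s hs => ?_
      equ := fun x hx s hs => ?_
      eqθ := fun x hx s hs => ?_
      bv0 := fun s hs => ?_
      bv2 := fun s hs => ?_
      bu := fun s hs => ?_
      bθ := fun s hs => ?_ }
  · have := hs.le
    rw [clampExt_eq _ (sub hx) this]
    exact hasDerivAt_clampExt_space hx this
      (hasDerivAt_pdx_iterate (h.diffx_v k hk x (sub hx) s this))
  · have := hs.le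
    rw [clampExt_eq _ (sub hx) this]
    exact hasDerivAt_clampExt_space hx this
      (hasDerivAt_pdx_iterate (h.diffx_u k hk x (sub hx) s this))
  · have := hs.le
    rw [clampExt_eq _ (sub hx) this]
    exact hasDerivAt_clampExt_space hx this
      (hasDerivAt_pdx_iterate (h.diffx_Θ k hk x (sub hx) s this))
  · rw [clampExt_eq _ (sub hx) hs.le]
    exact hasDerivAt_clampExt_time hx hs (h.difft_v x (sub hx) s hs.le).hasDerivAt
  · rw [clampExt_eq _ (sub hx) hs.le]
    exact hasDerivAt_clampExt_time hx hs (h.difft_u x (sub hx) s hs.le).hasDerivAt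
  · rw [clampExt_eq _ (sub hx) hs.le]
    exact hasDerivAt_clampExt_time hx hs (h.difft_Θ x (sub hx) s hs.le).hasDerivAt
  · simp only [clampExt_eq _ (sub hx) hs.le]
    rw [h.eq_v x hx s hs]
    congr 1
    exact (HasDerivAt.comp x (hf.hasDerivAt_f (h.Θ_pos x (sub hx) s hs.le))
      (hasDerivAt_pdx_iterate (k := 0) (h.diffx_Θ 0 (by norm_num) x (sub hx) s hs.le))).deriv
  · simp only [clampExt_eq _ (sub hx) hs.le]
    exact h.eq_u x hx s hs
  · simp only [clampExt_eq _ (sub hx) hs.le]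
    exact h.eq_Θ x hx s hs
  · rw [clampExt_eq _ ha hs.le, clampExt_eq _ hb hs.le]
    exact ⟨(h.bc_v s hs).1, (h.bc_v s hs).2.1⟩
  · rw [clampExt_eq _ ha hs.le, clampExt_eq _ hb hs.le]
    exact (h.bc_v s hs).2.2
  · rw [clampExt_eq _ ha hs.le, clampExt_eq _ hb hs.le]
    exact h.bc_u s hs
  · rw [clampExt_eq _ ha hs.le, clampExt_eq _ hb hs.le]
    exact h.bc_Θ s hs

lemma integral_clampExt_sq {a b : ℝ} (hab : a < b) (F : ℝ → ℝ → ℝ) {t : ℝ} (ht : 0 ≤ t) :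
    ∫ x in a..b, (clampExt a b F x t) ^ 2 = ∫ x in Ioo a b, (F x t) ^ 2 := by
  rw [intervalIntegral.integral_of_le hab.le, integral_Ioc_eq_integral_Ioo]
  refine setIntegral_congr_fun measurableSet_Ioo fun x hx => ?_
  simp only [clampExt_eq F (Ioo_subset_Icc_self hx) ht]

lemma pdx_iterate_eq_of_eqOn {a b t : ℝ} {w : ℝ → ℝ → ℝ} {g : ℝ → ℝ}
    (h : ∀ x ∈ Ioo a b, w x t = g x) (k : ℕ) : ∀ x ∈ Ioo a b, pdx^[k] w x t = deriv^[k] g x := by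
  induction k with
  | zero => exact h
  | succ k ih =>
    intro x hx
    rw [Function.iterate_succ_apply', Function.iterate_succ_apply']
    refine Filter.EventuallyEq.deriv_eq ?_
    filter_upwards [Ioo_mem_nhds hx.1 hx.2] with y hy using ih y hy

/-- The initial energy `½ ∫ (v₀'² + u₀''² + Θ₀'² + Θ₀²)`. -/
def initialEnergy (a b : ℝ) (v0 u0 Θ0 : ℝ → ℝ) : ℝ :=
  1 / 2 * ((∫ x in Ioo a b, (deriv v0 x) ^ 2) + (∫ x in Ioo a b, (deriv^[2] u0 x) ^ 2)
    + (∫ x in Ioo a b, (deriv Θ0 x) ^ 2) + ∫ x in Ioo a b, (Θ0 x) ^ 2)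

lemma IsClassicalSolEps.energy_zero {a b ε : ℝ} (hab : a < b) {f : ℝ → ℝ}
    {v0 u0 Θ0 : ℝ → ℝ} {v u Θ : ℝ → ℝ → ℝ} (h : IsClassicalSolEps a b f ε v0 u0 Θ0 v u Θ) :
    energy a b (fun k => clampExt a b (pdx^[k] v)) (fun k => clampExt a b (pdx^[k] u))
      (fun k => clampExt a b (pdx^[k] Θ)) 0 = initialEnergy a b v0 u0 Θ0 := by
  have eq : ∀ {w : ℝ → ℝ → ℝ} {g : ℝ → ℝ}, (∀ x ∈ Icc a b, w x 0 = g x) → ∀ k,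
      ∫ x in a..b, (clampExt a b (pdx^[k] w) x 0) ^ 2 = ∫ x in Ioo a b, (deriv^[k] g x) ^ 2 := by
    intro w g hw k
    rw [integral_clampExt_sq hab _ le_rfl]
    refine setIntegral_congr_fun measurableSet_Ioo fun x hx => ?_
    simp only [pdx_iterate_eq_of_eqOn (fun y hy => hw y (Ioo_subset_Icc_self hy)) k x hx]
  simp only [energy, eq fun x hx => (h.init x hx).1, eq fun x hx => (h.init x hx).2.1,
    eq fun x hx => (h.init x hx).2.2]
  rfl

/-- Lemma 4.5: ε-independent short-time higher-order estimates. -/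
theorem statement14
    (a b : ℝ) (hab : a < b)
    (f f' f'' : ℝ → ℝ) (hf : HypF f f' f'')
    (v0 u0 Θ0 : ℝ → ℝ) (hdata : SmoothData a b v0 u0 Θ0)
    (v u Θ : ℝ → ℝ → ℝ → ℝ)
    (hsol : ∀ ε ∈ Ioo (0 : ℝ) 1, IsClassicalSolEps a b f ε v0 u0 Θ0 (v ε) (u ε) (Θ ε)) :
    ∃ τ > (0 : ℝ), ∃ C > (0 : ℝ), ∀ ε ∈ Ioo (0 : ℝ) 1,
      (∀ t ∈ Ioo 0 τ,
        (∫ x in Ioo a b, (pdx (v ε) x t) ^ 2) ≤ C ∧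
        (∫ x in Ioo a b, (pdx^[2] (u ε) x t) ^ 2) ≤ C ∧
        (∫ x in Ioo a b, (pdx (Θ ε) x t) ^ 2) ≤ C) ∧
      (∫ t in Ioo (0 : ℝ) τ, ∫ x in Ioo a b, (pdx^[2] (Θ ε) x t) ^ 2) ≤ C := by
  obtain ⟨M, hM⟩ := hf.bdd
  have hM0 : 0 ≤ M := (abs_nonneg _).trans (hM 0 self_mem_Ici).1
  set K := energyConst (b - a) M
  have hK : 0 ≤ K := energyConst_nonneg (sub_pos.2 hab) hM0
  set Y0 := initialEnergy a b v0 u0 Θ0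
  set δ := Real.pi / 2 - Real.arctan Y0 with hδdef
  have hδ : 0 < δ := sub_pos.2 (Real.arctan_lt_pi_div_two Y0)
  set τ := δ / (2 * (K + 1)) with hτdef
  have hτ : 0 < τ := by positivity
  have hKτ : K * τ < δ := by
    rw [hτdef, mul_div_assoc', div_lt_iff₀ (by positivity)]
    nlinarith [mul_nonneg hK hδ.le]
  set R := Real.tan (Real.arctan Y0 + K * τ)
  refine ⟨τ, hτ, max 1 (max (2 * R) (2 * (Y0 + K * τ * (1 + R ^ 2)))), by positivity,
    fun ε hε => ?_⟩
  have h := hsol ε hε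
  have hx := h.extendedSol hab hf
  have nn : ∀ (F : ℝ → ℝ → ℝ) (t : ℝ), 0 ≤ ∫ x in a..b, (F x t) ^ 2 := fun F t =>
    intervalIntegral.integral_nonneg hab.le fun x _ => sq_nonneg _
  obtain ⟨h1, h2⟩ := quadratic_gronwall (θ := Real.arctan Y0 + K * τ) hx.continuous_energy
    (D := fun t => ∫ x in a..b, (clampExt a b (pdx^[2] (Θ ε)) x t) ^ 2)
    (fun t => by
      unfold energy
      have := nn (clampExt a b (pdx^[1] (v ε))) t
      have := nn (clampExt a b (pdx^[2] (u ε))) t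
      have := nn (clampExt a b (pdx^[1] (Θ ε))) t
      have := nn (clampExt a b (pdx^[0] (Θ ε))) t
      positivity)
    (fun t => nn _ t) hK hτ (by rw [h.energy_zero hab]) (by linarith)
    fun T hT => hx.energy_le hab hε.1 hf hM hT
  rw [h.energy_zero hab] at h2
  constructor
  · intro t ht
    have hY := h1 t (Ioo_subset_Ioc_self ht)
    have hv := integral_clampExt_sq hab (pdx^[1] (v ε)) ht.1.le
    have hu := integral_clampExt_sq hab (pdx^[2] (u ε)) ht.1.le
    have hΘ := integral_clampExt_sq hab (pdx^[1] (Θ ε)) ht.1.le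
    have nv := nn (clampExt a b (pdx^[1] (v ε))) t
    have nu := nn (clampExt a b (pdx^[2] (u ε))) t
    have nΘ1 := nn (clampExt a b (pdx^[1] (Θ ε))) t
    have nΘ0 := nn (clampExt a b (pdx^[0] (Θ ε))) t
    simp only [energy] at hY
    rw [hv] at hY nv
    rw [hu] at hY nu
    rw [hΘ] at hY nΘ1
    simp only [Function.iterate_one] at hY nv nΘ1
    have hC : 2 * R ≤ max 1 (max (2 * R) (2 * (Y0 + K * τ * (1 + R ^ 2)))) :=
      (le_max_left _ _).trans (le_max_right _ _)
    refine ⟨?_, ?_, ?_⟩ <;> refine le_trans ?_ hC <;> linarith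
  · refine le_trans ?_ ((le_max_right _ _).trans (le_max_right _ _))
    refine le_trans (le_of_eq ?_) h2
    rw [intervalIntegral.integral_of_le hτ.le, integral_Ioc_eq_integral_Ioo]
    refine setIntegral_congr_fun measurableSet_Ioo fun t ht => ?_
    exact (integral_clampExt_sq hab _ ht.1.le).symm
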